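/- For every s ∈ ℂ with Re s > 0, the logarithmic derivative of the Gamma function satisfies Γ'(s/2)/Γ(s/2) = ∫₀^{+∞} ( e^{−u}/u − e^{−u s/2}/(1 − e^{−u}) ) du. -/

import Mathlib

open Complex Set

open MeasureTheory Filter Topology

theorem image_exp_neg_Ioi_zero : (fun u : ℝ ↦ Real.exp (-u)) '' Ioi 0 = Ioo 0 1 := by
  ext x
  constructor
  · rintro ⟨u, hu, rfl⟩
    exact ⟨Real.exp_pos _, Real.exp_lt_one_iff.2 (by simpa using hu)⟩
  · rintro ⟨h0, h1⟩
    exact ⟨-Real.log x, by simpa using Real.log_neg h0 h1, by simp [Real.exp_log h0]⟩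

theorem hasDerivWithinAt_exp_neg (u : ℝ) (S : Set ℝ) :
    HasDerivWithinAt (fun u : ℝ ↦ Real.exp (-u)) (-Real.exp (-u)) S u := by
  simpa using ((hasDerivAt_id u).neg.exp).hasDerivWithinAt

theorem injOn_exp_neg (S : Set ℝ) : InjOn (fun u : ℝ ↦ Real.exp (-u)) S :=
  fun _ _ _ _ h ↦ neg_injective (Real.exp_injective h)

/-- The integrand of the Beta function after the substitution `x = exp (-u)`. -/
theorem abs_neg_exp_smul_betaIntegrand (z : ℂ) (t : ℝ) {u : ℝ} (hu : 0 < u) :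
    |-Real.exp (-u)| •
        (((Real.exp (-u) : ℝ) : ℂ) ^ (z - 1) * (1 - ((Real.exp (-u) : ℝ) : ℂ)) ^ ((t : ℂ) - 1)) =
      exp (-(u : ℂ) * z) * (((1 - Real.exp (-u)) ^ (t - 1) : ℝ) : ℂ) := by
  have hw : 0 ≤ 1 - Real.exp (-u) := by
    have : Real.exp (-u) < 1 := Real.exp_lt_one_iff.2 (by simpa using hu)
    linarith
  have h : ((Real.exp (-u) : ℝ) : ℂ) ^ (z - 1) = exp (-(u : ℂ) * (z - 1)) := by
    rw [cpow_def_of_ne_zero (by exact_mod_cast (Real.exp_pos _).ne'), ← ofReal_log (Real.exp_pos _).le,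
      Real.log_exp]
    push_cast
    rfl
  rw [abs_neg, abs_of_pos (Real.exp_pos _), real_smul, h, ofReal_cpow hw, ofReal_exp, ← mul_assoc,
    ← Complex.exp_add]
  push_cast
  ring_nf

theorem integrableOn_exp_mul_one_sub_exp_rpow {z : ℂ} (hz : 0 < z.re) {t : ℝ} (ht : 0 < t) :
    IntegrableOn
      (fun u : ℝ ↦ exp (-(u : ℂ) * z) * (((1 - Real.exp (-u)) ^ (t - 1) : ℝ) : ℂ)) (Ioi 0) := by
  have h := betaIntegral_convergent hz (v := t) (by simpa using ht)
  rw [intervalIntegrable_iff_integrableOn_Ioo_of_le zero_le_one, ← image_exp_neg_Ioi_zero,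
    integrableOn_image_iff_integrableOn_abs_deriv_smul measurableSet_Ioi
      (fun u _ ↦ hasDerivWithinAt_exp_neg u _) (injOn_exp_neg _)] at h
  exact h.congr_fun (fun u hu ↦ abs_neg_exp_smul_betaIntegrand z t hu) measurableSet_Ioi

theorem betaIntegral_eq_integral_Ioi (z : ℂ) (t : ℝ) :
    betaIntegral z t =
      ∫ u in Ioi (0 : ℝ), exp (-(u : ℂ) * z) * (((1 - Real.exp (-u)) ^ (t - 1) : ℝ) : ℂ) := by
  rw [betaIntegral, intervalIntegral.integral_of_le zero_le_one, integral_Ioc_eq_integral_Ioo,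
    ← image_exp_neg_Ioi_zero,
    integral_image_eq_integral_abs_deriv_smul measurableSet_Ioi
      (fun u _ ↦ hasDerivWithinAt_exp_neg u _) (injOn_exp_neg _)]
  exact setIntegral_congr_fun measurableSet_Ioi
    fun u hu ↦ abs_neg_exp_smul_betaIntegrand z t hu

theorem exp_neg_mul_cpow_eq_ofReal_rpow (t : ℝ) {u : ℝ} (hu : 0 < u) :
    ((Real.exp (-u) : ℝ) : ℂ) * (u : ℂ) ^ ((t : ℂ) - 1) =
      exp (-(u : ℂ)) * ((u ^ (t - 1) : ℝ) : ℂ) := by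
  rw [ofReal_cpow hu.le]
  push_cast
  rfl

theorem integrableOn_exp_neg_mul_rpow {t : ℝ} (ht : 0 < t) :
    IntegrableOn (fun u : ℝ ↦ exp (-(u : ℂ)) * ((u ^ (t - 1) : ℝ) : ℂ)) (Ioi 0) :=
  (GammaIntegral_convergent (s := t) (by simpa using ht)).congr_fun
    (fun _ hu ↦ exp_neg_mul_cpow_eq_ofReal_rpow t hu) measurableSet_Ioi

theorem Gamma_ofReal_eq_integral_Ioi {t : ℝ} (ht : 0 < t) :
    Gamma t = ∫ u in Ioi (0 : ℝ), exp (-(u : ℂ)) * ((u ^ (t - 1) : ℝ) : ℂ) := by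
  rw [Gamma_eq_integral (by simpa using ht), GammaIntegral]
  exact setIntegral_congr_fun measurableSet_Ioi
    fun _ hu ↦ exp_neg_mul_cpow_eq_ofReal_rpow t hu

theorem rpow_sub_one_le_one_add_inv {u t : ℝ} (hu : 0 < u) (ht0 : 0 ≤ t) (ht1 : t ≤ 1) :
    u ^ (t - 1) ≤ 1 + u⁻¹ := by
  rcases le_total 1 u with h | h
  · have := Real.rpow_le_one_of_one_le_of_nonpos h (show t - 1 ≤ 0 by linarith)
    have := inv_pos.2 hu
    linarith
  · have := Real.rpow_le_rpow_of_exponent_ge hu h (show -1 ≤ t - 1 by linarith)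
    rw [Real.rpow_neg_one] at this
    linarith

theorem abs_rpow_sub_one_exp_sub_le_one {u t : ℝ} (hu : 0 < u) (ht0 : 0 ≤ t) (ht1 : t ≤ 1) :
    |u ^ (t - 1) - (1 - Real.exp (-u)) ^ (t - 1)| ≤ 1 := by
  have he : Real.exp (-u) < 1 := Real.exp_lt_one_iff.2 (by simpa using hu)
  have hp := Real.exp_pos (-u)
  have hwu : 1 - Real.exp (-u) ≤ u := by linarith [Real.add_one_le_exp (-u)]
  have hinv : (1 - Real.exp (-u))⁻¹ - u⁻¹ ≤ 1 := by
    have hmul : (1 + u) * Real.exp (-u) ≤ 1 := by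
      rw [Real.exp_neg, ← div_eq_mul_inv, div_le_one (Real.exp_pos u)]
      linarith [Real.add_one_le_exp u]
    have hw : 0 < 1 - Real.exp (-u) := by linarith
    rw [inv_sub_inv hw.ne' hu.ne', div_le_one (by positivity)]
    linarith
  generalize hw' : 1 - Real.exp (-u) = w at *
  have hw : 0 < w := by linarith
  have hw1 : w ≤ 1 := by linarith
  have hmono : u ^ (t - 1) ≤ w ^ (t - 1) :=
    Real.rpow_le_rpow_of_nonpos hw hwu (by linarith)
  have hpow : w ^ (t - 1) ≤ w⁻¹ := by
    rw [← Real.rpow_neg_one]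
    exact Real.rpow_le_rpow_of_exponent_ge hw hw1 (by linarith)
  have hq : w / u ≤ (w / u) ^ (1 - t) := by
    simpa using Real.rpow_le_rpow_of_exponent_ge (div_pos hw hu) ((div_le_one hu).2 hwu)
      (show 1 - t ≤ 1 by linarith)
  have hfac : u ^ (t - 1) = w ^ (t - 1) * (w / u) ^ (1 - t) := by
    rw [Real.div_rpow hw.le hu.le, ← mul_div_assoc, ← Real.rpow_add hw, ← neg_sub t 1,
      Real.rpow_neg hu.le]
    simp
  rw [abs_sub_comm, abs_of_nonneg (by linarith)]
  calc w ^ (t - 1) - u ^ (t - 1) = w ^ (t - 1) * (1 - (w / u) ^ (1 - t)) := by rw [hfac]; ring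
    _ ≤ w ^ (t - 1) * (1 - w / u) := by gcongr
    _ ≤ w⁻¹ * (1 - w / u) := by
      gcongr
      linarith [(div_le_one hu).2 hwu]
    _ = w⁻¹ - u⁻¹ := by field_simp
    _ ≤ 1 := hinv

theorem norm_exp_sub_exp_le {c : ℝ} {x y : ℂ} (hx : x.re ≤ c) (hy : y.re ≤ c) :
    ‖exp x - exp y‖ ≤ Real.exp c * ‖x - y‖ :=
  (convex_halfSpace_re_le c).norm_image_sub_le_of_norm_hasDerivWithin_le
    (fun w _ ↦ (hasDerivAt_exp w).hasDerivWithinAt)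
    (fun w hw ↦ by rw [norm_exp]; exact Real.exp_le_exp.2 hw) hy hx

theorem norm_Gamma_sub_beta_integrand_le (z : ℂ) {u t : ℝ} (hu : 0 < u)
    (ht0 : 0 ≤ t) (ht1 : t ≤ 1) :
    ‖exp (-(u : ℂ)) * ((u ^ (t - 1) : ℝ) : ℂ) -
        exp (-(u : ℂ) * z) * (((1 - Real.exp (-u)) ^ (t - 1) : ℝ) : ℂ)‖ ≤
      ‖z - 1‖ * ((u + 1) * Real.exp (-(min 1 z.re * u))) + Real.exp (-(z.re * u)) := by
  have hsplit : exp (-(u : ℂ)) * ((u ^ (t - 1) : ℝ) : ℂ) -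
      exp (-(u : ℂ) * z) * (((1 - Real.exp (-u)) ^ (t - 1) : ℝ) : ℂ) =
      (exp (-(u : ℂ)) - exp (-(u : ℂ) * z)) * ((u ^ (t - 1) : ℝ) : ℂ) +
      exp (-(u : ℂ) * z) * ((u ^ (t - 1) - (1 - Real.exp (-u)) ^ (t - 1) : ℝ) : ℂ) := by
    push_cast
    ring
  rw [hsplit]
  refine (norm_add_le _ _).trans (add_le_add ?_ ?_)
  · have h1 : ‖exp (-(u : ℂ)) - exp (-(u : ℂ) * z)‖ ≤
        Real.exp (-(min 1 z.re * u)) * ‖-(u : ℂ) - -(u : ℂ) * z‖ := by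
      refine norm_exp_sub_exp_le ?_ ?_
      · have := mul_le_mul_of_nonneg_right (min_le_left 1 z.re) hu.le
        simp only [neg_re, ofReal_re]
        linarith
      · have := mul_le_mul_of_nonneg_right (min_le_right 1 z.re) hu.le
        simp only [mul_re, neg_re, ofReal_re, neg_im, ofReal_im]
        linarith
    have h2 : ‖-(u : ℂ) - -(u : ℂ) * z‖ = u * ‖z - 1‖ := by
      rw [show -(u : ℂ) - -(u : ℂ) * z = u * (z - 1) by ring, norm_mul, norm_real,
        Real.norm_of_nonneg hu.le]
    rw [norm_mul, norm_real, Real.norm_of_nonneg (by positivity)]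
    rw [h2] at h1
    calc _ ≤ Real.exp (-(min 1 z.re * u)) * (u * ‖z - 1‖) * (1 + u⁻¹) := by
          gcongr
          exact rpow_sub_one_le_one_add_inv hu ht0 ht1
      _ = _ := by field_simp
  · rw [norm_mul, norm_exp, norm_real]
    calc _ ≤ Real.exp (-(u : ℂ) * z).re * 1 := by
          gcongr
          exact abs_rpow_sub_one_exp_sub_le_one hu ht0 ht1
      _ = _ := by simp [mul_comm]

theorem integrableOn_exp_neg_mul {a : ℝ} (ha : 0 < a) :
    IntegrableOn (fun u : ℝ ↦ Real.exp (-(a * u))) (Ioi 0) := by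
  simpa using exp_neg_integrableOn_Ioi 0 ha

theorem integrableOn_add_one_mul_exp_neg_mul {a : ℝ} (ha : 0 < a) :
    IntegrableOn (fun u : ℝ ↦ (u + 1) * Real.exp (-(a * u))) (Ioi 0) := by
  have h := integrableOn_rpow_mul_exp_neg_mul_rpow (s := 1) (p := 1) (b := a) (by norm_num)
    one_pos ha
  simp only [add_mul, one_mul]
  exact Integrable.add (by simpa [IntegrableOn] using h) (integrableOn_exp_neg_mul ha)

theorem tendsto_Gamma_mul_sub_div {z : ℂ} (hz : 0 < z.re) :
    Tendsto (fun t : ℝ ↦ Gamma t - betaIntegral z t) (𝓝[>] 0)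
      (𝓝 (deriv Gamma z / Gamma z)) := by
  have hne : ∀ m : ℕ, z ≠ -m := by
    rintro m rfl
    have : (0 : ℝ) ≤ m := m.cast_nonneg
    simp at hz
    linarith
  have hd := differentiableAt_Gamma z hne
  have hcast : Tendsto (fun t : ℝ ↦ (t : ℂ)) (𝓝[>] 0) (𝓝[≠] 0) := by
    refine tendsto_nhdsWithin_iff.2 ⟨?_, ?_⟩
    · exact (by simpa using (continuous_ofReal.tendsto (0 : ℝ)) :
        Tendsto (fun t : ℝ ↦ (t : ℂ)) (𝓝 0) (𝓝 0)).mono_left nhdsWithin_le_nhds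
    · filter_upwards [self_mem_nhdsWithin] with t ht
      simpa using (ne_of_gt ht : t ≠ 0)
  have h1 : Tendsto (fun t : ℂ ↦ t⁻¹ • (Gamma (z + t) - Gamma z)) (𝓝[≠] 0) (𝓝 (deriv Gamma z)) :=
    hd.hasDerivAt.tendsto_slope_zero
  have h2 : Tendsto (fun t : ℂ ↦ Gamma (z + t)) (𝓝[≠] 0) (𝓝 (Gamma z)) := by
    have : ContinuousAt (fun t : ℂ ↦ Gamma (z + t)) 0 :=
      ContinuousAt.comp (g := Gamma) (by simpa using hd.continuousAt) (by fun_prop)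
    simpa using this.tendsto.mono_left nhdsWithin_le_nhds
  have h3 := ((tendsto_self_mul_Gamma_nhds_zero.mul h1).div h2
    (Gamma_ne_zero_of_re_pos hz)).comp hcast
  rw [one_mul] at h3
  refine h3.congr' ?_
  filter_upwards [self_mem_nhdsWithin] with t (ht : 0 < t)
  have ht' : (t : ℂ) ≠ 0 := by exact_mod_cast ht.ne'
  have hzt : Gamma (z + t) ≠ 0 := Gamma_ne_zero_of_re_pos (by simp; linarith)
  simp only [Function.comp_apply, smul_eq_mul, Pi.div_apply,
    betaIntegral_eq_Gamma_mul_div z t hz (by simpa using ht)]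
  field_simp

/-- **Gauss' integral representation** of the logarithmic derivative of the Gamma function. -/
theorem deriv_Gamma_div_Gamma_eq_integral {z : ℂ} (hz : 0 < z.re) :
    deriv Gamma z / Gamma z =
      ∫ u in Ioi (0 : ℝ), (exp (-(u : ℂ)) / u - exp (-(u : ℂ) * z) / (1 - exp (-(u : ℂ)))) := by
  refine tendsto_nhds_unique (tendsto_Gamma_mul_sub_div hz) ?_
  have hlim : Tendsto (fun t : ℝ ↦ ∫ u in Ioi (0 : ℝ),
      (exp (-(u : ℂ)) * ((u ^ (t - 1) : ℝ) : ℂ) -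
        exp (-(u : ℂ) * z) * (((1 - Real.exp (-u)) ^ (t - 1) : ℝ) : ℂ))) (𝓝[>] 0)
      (𝓝 (∫ u in Ioi (0 : ℝ),
        (exp (-(u : ℂ)) / u - exp (-(u : ℂ) * z) / (1 - exp (-(u : ℂ)))))) := by
    refine tendsto_integral_filter_of_dominated_convergence
      (fun u ↦ ‖z - 1‖ * ((u + 1) * Real.exp (-(min 1 z.re * u))) + Real.exp (-(z.re * u)))
      ?_ ?_ ?_ ?_
    · filter_upwards [self_mem_nhdsWithin] with t ht
      exact ((integrableOn_exp_neg_mul_rpow ht).sub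
        (integrableOn_exp_mul_one_sub_exp_rpow hz ht)).aestronglyMeasurable
    · filter_upwards [Ioc_mem_nhdsGT zero_lt_one] with t ht
      filter_upwards [ae_restrict_mem measurableSet_Ioi] with u hu
      exact norm_Gamma_sub_beta_integrand_le z hu ht.1.le ht.2
    · exact ((integrableOn_add_one_mul_exp_neg_mul (lt_min one_pos hz)).const_mul _).add
        (integrableOn_exp_neg_mul hz)
    · filter_upwards [ae_restrict_mem measurableSet_Ioi] with u (hu : 0 < u)
      have hw : 0 < 1 - Real.exp (-u) := by
        have : Real.exp (-u) < 1 := Real.exp_lt_one_iff.2 (by simpa using hu)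
        linarith
      have hpow {x : ℝ} (hx : 0 < x) :
          Tendsto (fun t : ℝ ↦ ((x ^ (t - 1) : ℝ) : ℂ)) (𝓝[>] 0) (𝓝 ((x : ℂ)⁻¹)) := by
        have h : ContinuousAt (fun t : ℝ ↦ ((x ^ (t - 1) : ℝ) : ℂ)) 0 :=
          continuous_ofReal.continuousAt.comp
            (continuousAt_const.rpow (by fun_prop) (Or.inl hx.ne'))
        simpa [Real.rpow_neg_one] using h.tendsto.mono_left nhdsWithin_le_nhds
      have h := ((hpow hu).const_mul (exp (-(u : ℂ)))).sub
        ((hpow hw).const_mul (exp (-(u : ℂ) * z)))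
      simpa [div_eq_mul_inv] using h
  refine hlim.congr' ?_
  filter_upwards [self_mem_nhdsWithin] with t ht
  rw [integral_sub (integrableOn_exp_neg_mul_rpow ht)
    (integrableOn_exp_mul_one_sub_exp_rpow hz ht), ← Gamma_ofReal_eq_integral_Ioi ht,
    ← betaIntegral_eq_integral_Ioi]

/-- For `Re s > 0`, the logarithmic derivative of the Gamma function satisfies
`Γ'(s/2)/Γ(s/2) = ∫₀^∞ (e^{−u}/u − e^{−u·s/2}/(1 − e^{−u})) du`. -/
theorem statement16 (s : ℂ) (hs : 0 < s.re) :
    deriv Complex.Gamma (s / 2) / Complex.Gamma (s / 2) =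
      ∫ u in Ioi (0 : ℝ),
        (Complex.exp (-(u : ℂ)) / (u : ℂ)
          - Complex.exp (-(u : ℂ) * s / 2) / (1 - Complex.exp (-(u : ℂ)))) := by
  have hz : 0 < (s / 2).re := by simpa using hs
  simpa only [mul_div_assoc] using deriv_Gamma_div_Gamma_eq_integral hz
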